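/- arXiv:2310.01131 — 2 statements merged into one kernel-verified Lean document; each statement's English description precedes it below -/
import Mathlib

section
/- For every integer n ≥ 1 there exists a K-algebra isomorphism between the type B Temperley–Lieb algebra TL(B_n) and the centralizer {A ∈ Module.End K W_n : A ∘ B_n = B_n ∘ A} of B_n in the endomorphism algebra of W_n. -/
set_option synthInstance.maxHeartbeats 1000000
set_option maxHeartbeats 1000000

noncomputable section

/-- The ground field `K = ℂ(q)`, the complex rational functions. -/
abbrev K : Type := RatFunc ℂ

/-- The variable `q ∈ K = ℂ(q)`. -/
noncomputable def q : K := RatFunc.X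

/-- The quantum integer `[m] = (q^m - q^{-m})/(q - q⁻¹) ∈ K`, for `m : ℤ`. -/
noncomputable def qint (m : ℤ) : K := (q ^ m - q ^ (-m)) / (q - q⁻¹)

/-- `W n` is the `K`-vector space of functions `(Fin n → Bool) → K`, with standard basis
indexed by the words of length `n` in the letters `x` (encoded `false`) and `y` (encoded
`true`); it models the tensor power `V^{⊗n}` of the standard representation of
`U_q(gl₂)`. -/
abbrev W (n : ℕ) : Type := (Fin n → Bool) → K

/-- `ε(x) = -1`, `ε(y) = 1`. -/
def eps (b : Bool) : ℤ := if b then 1 else -1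

/-- The word `w` with its `i`-th letter flipped. -/
def flipLetter (n : ℕ) (w : Fin n → Bool) (i : Fin n) : Fin n → Bool :=
  Function.update w i (!(w i))

/-- The `K`-linear endomorphism `B` of `W n = V^{⊗n}` given on basis vectors by
`B e_w = Σ_{i=0}^{n-1} (Π_{j=i+1}^{n-1} q^{ε(w_j)}) e_{w⁽ⁱ⁾}`; it is the action on `V^{⊗n}`
of the generator `B = q⁻¹EK⁻¹ + F` of the coideal subalgebra `U_q'(gl₁ × gl₁)` of
`U_q(gl₂)`. -/
noncomputable def Bop (n : ℕ) : Module.End K (W n) where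
  toFun f := fun u => ∑ i : Fin n,
    (∏ j ∈ Finset.univ.filter (fun j => i < j), q ^ eps (u j)) * f (flipLetter n u i)
  map_add' f g := by
    funext u
    simp only [Pi.add_apply, mul_add]
    rw [Finset.sum_add_distrib]
  map_smul' c f := by
    funext u
    simp only [Pi.smul_apply, smul_eq_mul, RingHom.id_apply]
    rw [Finset.mul_sum]
    exact Finset.sum_congr rfl fun i _ => by ring

/-- `δ = q + q⁻¹ ∈ K`. -/
noncomputable def δ : K := q + q⁻¹

/-- Defining relations of the type `B` Temperley–Lieb algebra `TL(Bₙ)` (over `K`, with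
`δ = q + q⁻¹`): the generator of index `0` is `s₀` and the generator of index `i`
(for `1 ≤ i ≤ n-1`) is `Uᵢ`.  The relations are `Uᵢ² = δUᵢ`, `UᵢU_{i+1}Uᵢ = Uᵢ`,
`U_{i+1}UᵢU_{i+1} = U_{i+1}`, `UᵢUⱼ = UⱼUᵢ` for `|i-j| ≥ 2`, `s₀² = 1`, `U₁s₀U₁ = 0` and
`s₀Uᵢ = Uᵢs₀` for `i ≥ 2`. -/
inductive TLBRel (n : ℕ) : FreeAlgebra K (Fin n) → FreeAlgebra K (Fin n) → Prop
  | Usq (i : Fin n) (hi : 1 ≤ (i : ℕ)) :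
      TLBRel n (FreeAlgebra.ι K i * FreeAlgebra.ι K i) (δ • FreeAlgebra.ι K i)
  | braid₁ (i j : Fin n) (hi : 1 ≤ (i : ℕ)) (hj : (j : ℕ) = (i : ℕ) + 1) :
      TLBRel n (FreeAlgebra.ι K i * FreeAlgebra.ι K j * FreeAlgebra.ι K i) (FreeAlgebra.ι K i)
  | braid₂ (i j : Fin n) (hi : 1 ≤ (i : ℕ)) (hj : (j : ℕ) = (i : ℕ) + 1) :
      TLBRel n (FreeAlgebra.ι K j * FreeAlgebra.ι K i * FreeAlgebra.ι K j) (FreeAlgebra.ι K j)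
  | Ucomm (i j : Fin n) (hi : 1 ≤ (i : ℕ)) (h : (i : ℕ) + 2 ≤ (j : ℕ)) :
      TLBRel n (FreeAlgebra.ι K i * FreeAlgebra.ι K j) (FreeAlgebra.ι K j * FreeAlgebra.ι K i)
  | s0sq (i : Fin n) (hi : (i : ℕ) = 0) : TLBRel n (FreeAlgebra.ι K i * FreeAlgebra.ι K i) 1
  | UsU (i j : Fin n) (hi : (i : ℕ) = 0) (hj : (j : ℕ) = 1) :
      TLBRel n (FreeAlgebra.ι K j * FreeAlgebra.ι K i * FreeAlgebra.ι K j) 0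
  | s0comm (i j : Fin n) (hi : (i : ℕ) = 0) (h : 2 ≤ (j : ℕ)) :
      TLBRel n (FreeAlgebra.ι K i * FreeAlgebra.ι K j) (FreeAlgebra.ι K j * FreeAlgebra.ι K i)

/-- The type `B` Temperley–Lieb algebra `TL(Bₙ)` over `K = ℂ(q)` with `δ = q + q⁻¹`. -/
abbrev TLB (n : ℕ) := RingQuot (TLBRel n)

namespace TypeBTL

open Matrix (single single_apply diagonal diagonal_apply_ne diagonal_mul_diagonal diagonal_one
  of_apply mul_apply one_apply)

/-! ### Arithmetic in `ℂ(q)` -/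

theorem q_ne_zero : q ≠ 0 := RatFunc.X_ne_zero

theorem q_pow_eq_one {n : ℕ} (h : q ^ n = 1) : n = 0 := by
  have h' : (Polynomial.X ^ n : Polynomial ℂ) = 1 := by
    apply RatFunc.algebraMap_injective ℂ
    simpa [q] using h
  simpa using congrArg Polynomial.natDegree h'

theorem q_zpow_eq_one {m : ℤ} (h : q ^ m = 1) : m = 0 := by
  obtain ⟨n, rfl | rfl⟩ := m.eq_nat_or_neg
  · simpa using q_pow_eq_one (n := n) (by simpa using h)
  · simpa using q_pow_eq_one (n := n) (by simpa using h)

theorem one_add_q_zpow_ne_zero (m : ℤ) : 1 + q ^ m ≠ 0 := by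
  intro h
  have h1 : q ^ m = -1 := by linear_combination h
  have h2 : q ^ (m + m) = 1 := by rw [zpow_add₀ q_ne_zero, h1]; ring
  have h3 : m = 0 := by have := q_zpow_eq_one h2; omega
  rw [h3] at h
  norm_num at h

/-- The element `q ^ k + q ^ (-k)`. -/
def qsum (k : ℤ) : K := q ^ k + q ^ (-k)

theorem qsum_ne_zero (k : ℤ) : qsum k ≠ 0 := by
  have h : qsum k = q ^ (-k) * (1 + q ^ (k + k)) := by
    rw [qsum, mul_add, ← zpow_add₀ q_ne_zero]
    ring_nf
  rw [h]
  exact mul_ne_zero (zpow_ne_zero _ q_ne_zero) (one_add_q_zpow_ne_zero _)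

theorem qsum_neg (k : ℤ) : qsum (-k) = qsum k := by
  rw [qsum, qsum, neg_neg, add_comm]

theorem qsum_add_qsum (k : ℤ) : qsum (k + 1) + qsum (k - 1) = δ * qsum k := by
  simp only [qsum, δ, neg_add, sub_eq_add_neg, zpow_add₀ q_ne_zero, zpow_neg, zpow_one,
    neg_neg]
  ring

theorem q_sub_inv_ne_zero : q - q⁻¹ ≠ 0 := by
  intro h
  have h1 : q ^ 2 = 1 := by
    have := q_ne_zero
    field_simp at h
    linear_combination h
  simpa using q_pow_eq_one h1

theorem qint_injective : Function.Injective qint := by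
  intro k l h
  have h1 : q ^ k - q ^ (-k) = q ^ l - q ^ (-l) := by
    simpa [qint, div_left_inj' q_sub_inv_ne_zero] using h
  have h2 : (q ^ (k - l) - 1) * (1 + q ^ (-(k + l))) = 0 := by
    have hk := zpow_ne_zero k q_ne_zero
    have hl := zpow_ne_zero l q_ne_zero
    simp only [neg_add, sub_eq_add_neg, zpow_add₀ q_ne_zero, zpow_neg] at h1 ⊢
    field_simp at h1 ⊢
    linear_combination h1
  rcases mul_eq_zero.1 h2 with h3 | h3
  · have := q_zpow_eq_one (sub_eq_zero.1 h3)
    omega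
  · exact absurd h3 (one_add_q_zpow_ne_zero _)

/-! ### Words of signs -/

/-- Words of length `n` in the letters `true` (a step up) and `false` (a step down). -/
inductive Word : ℕ → Type
  | nil : Word 0
  | snoc {n : ℕ} : Word n → Bool → Word (n + 1)
  deriving DecidableEq

/-- Splitting off the last letter of a word. -/
def snocEquiv (n : ℕ) : Word n × Bool ≃ Word (n + 1) where
  toFun p := .snoc p.1 p.2
  invFun | .snoc S a => (S, a)
  left_inv _ := rfl
  right_inv | .snoc _ _ => rfl

instance instFintypeWord : (n : ℕ) → Fintype (Word n)
  | 0 => ⟨{.nil}, fun | .nil => by simp⟩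
  | n + 1 => letI := instFintypeWord n; Fintype.ofEquiv _ (snocEquiv n)

theorem card_word (n : ℕ) : Fintype.card (Word n) = 2 ^ n := by
  induction n with
  | zero => rfl
  | succ n ih => rw [← Fintype.card_congr (snocEquiv n), Fintype.card_prod, ih]; simp [pow_succ]

theorem sum_snoc {M : Type*} [AddCommMonoid M] {n : ℕ} (F : Word (n + 1) → M) :
    ∑ S, F S = ∑ S : Word n, (F (S.snoc true) + F (S.snoc false)) := by
  rw [← (snocEquiv n).sum_comp, Fintype.sum_prod_type]
  simp only [Fintype.sum_bool]
  rfl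

/-- The height of the endpoint of the path with steps `S`. -/
def wt : {n : ℕ} → Word n → ℤ
  | _, .nil => 0
  | _, .snoc S a => wt S + eps a

/-- The word all of whose letters are `a`. -/
def constWord (a : Bool) : (n : ℕ) → Word n
  | 0 => .nil
  | n + 1 => .snoc (constWord a n) a

theorem wt_constWord (a : Bool) (n : ℕ) : wt (constWord a n) = n * eps a := by
  induction n with
  | zero => simp [constWord, wt]
  | succ n ih => simp [constWord, wt, ih]; ring

theorem abs_wt_le {n : ℕ} (S : Word n) : |wt S| ≤ n := by
  induction S with
  | nil => simp [wt]
  | @snoc n S a ih =>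
    rw [abs_le] at ih ⊢
    cases a <;> simp [wt, eps] <;> omega

theorem exists_wt_eq_or_constWord {m : ℕ} (S : Word (m + 2)) :
    (∃ T : Word m, wt T = wt S) ∨ ∃ a, S = constWord a (m + 2) := by
  induction m with
  | zero =>
    obtain _ | ⟨_ | ⟨S, a⟩, b⟩ := S
    cases S
    by_cases h : a = b
    · exact .inr ⟨a, by rw [h]; rfl⟩
    · refine .inl ⟨.nil, ?_⟩
      cases a <;> cases b <;> simp_all [wt, eps]
  | succ m ih =>
    obtain _ | ⟨S, b⟩ := S
    obtain ⟨T, hT⟩ | ⟨a, rfl⟩ := ih S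
    · exact .inl ⟨T.snoc b, by simp [wt, hT]⟩
    · by_cases h : a = b
      · exact .inr ⟨a, by rw [h]; rfl⟩
      · refine .inl ⟨constWord a (m + 1), ?_⟩
        cases a <;> cases b <;> simp_all [wt, eps, wt_constWord] <;> ring

theorem wt_ne_wt_constWord {m : ℕ} (T : Word m) (a : Bool) : wt T ≠ wt (constWord a (m + 2)) := by
  intro h
  have hT := abs_wt_le T
  rw [h, wt_constWord, abs_le] at hT
  cases a <;> simp [eps] at hT

/-! ### Seminormal form -/

/-- The embedding `M ↦ M ⊗ 1` of matrices indexed by words. -/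
def inc (n : ℕ) : Matrix (Word n) (Word n) K →ₐ[K] Matrix (Word (n + 1)) (Word (n + 1)) K :=
  AlgHom.ofLinearMap
    { toFun := fun M => Matrix.of fun
        | .snoc S a, .snoc T b => if a = b then M S T else 0
      map_add' := fun M N => by
        ext (_ | ⟨S, a⟩) (_ | ⟨T, b⟩)
        simp only [of_apply, Matrix.add_apply]
        split_ifs <;> simp
      map_smul' := fun c M => by
        ext (_ | ⟨S, a⟩) (_ | ⟨T, b⟩)
        simp }
    (by
      ext (_ | ⟨S, a⟩) (_ | ⟨T, b⟩)
      simp [one_apply, ← ite_and, and_comm])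
    (by
      intro M N
      ext (_ | ⟨S, a⟩) (_ | ⟨T, b⟩)
      simp only [LinearMap.coe_mk, AddHom.coe_mk, of_apply, mul_apply, sum_snoc]
      cases a <;> cases b <;> simp)

@[simp]
theorem inc_snoc {n : ℕ} (M : Matrix (Word n) (Word n) K) (S T : Word n) (a b : Bool) :
    inc n M (S.snoc a) (T.snoc b) = if a = b then M S T else 0 := rfl

theorem inc_single {n : ℕ} (S T : Word n) :
    inc n (single S T 1) =
      single (S.snoc true) (T.snoc true) 1 + single (S.snoc false) (T.snoc false) 1 := by
  ext (_ | ⟨S', a⟩) (_ | ⟨T', b⟩)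
  cases a <;> cases b <;> simp [single_apply]

/-- The diagonal entry `(q ^ (k ± 1) + q ^ (-(k ± 1))) / (q ^ k + q ^ (-k))` of `Uᵢ` in
seminormal form. -/
def coef (k : ℤ) (a : Bool) : K := qsum (k + eps a) / qsum k

theorem coef_ne_zero (k : ℤ) (a : Bool) : coef k a ≠ 0 :=
  div_ne_zero (qsum_ne_zero _) (qsum_ne_zero _)

theorem coef_add_coef (k : ℤ) : coef k true + coef k false = δ := by
  rw [coef, coef, ← add_div, div_eq_iff (qsum_ne_zero k)]
  exact qsum_add_qsum k

theorem coef_mul_coef (k : ℤ) (a : Bool) : coef k a * coef (k + eps a) (!a) = 1 := by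
  have h : k + eps a + eps (!a) = k := by cases a <;> simp [eps]
  rw [coef, coef, h]
  have := qsum_ne_zero k
  have := qsum_ne_zero (k + eps a)
  field_simp

/-- The last generator `U_{m+1}` of `TL(B_{m+2})` in seminormal form. -/
def cupCap (m : ℕ) : Matrix (Word (m + 2)) (Word (m + 2)) K :=
  Matrix.of fun
    | .snoc (.snoc S a) b, .snoc (.snoc T c) d =>
      if a = b ∨ c = d then 0 else if S = T then coef (wt S) a else 0

@[simp]
theorem cupCap_snoc {m : ℕ} (S T : Word m) (a b c d : Bool) :
    cupCap m ((S.snoc a).snoc b) ((T.snoc c).snoc d) =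
      if a = b ∨ c = d then 0 else if S = T then coef (wt S) a else 0 := rfl

/-- The generators of `TL(Bₙ)` in seminormal form. -/
def gen : (n : ℕ) → ℕ → Matrix (Word n) (Word n) K
  | 0, _ => 0
  | 1, _ => diagonal fun | .snoc _ a => (eps a : K)
  | m + 2, i => if i = m + 1 then cupCap m else inc (m + 1) (gen (m + 1) i)

theorem gen_of_lt {n i : ℕ} (hi : i < n) : gen (n + 1) i = inc n (gen n i) := by
  obtain _ | m := n
  · omega
  · rw [gen, if_neg (by omega)]

theorem gen_last (m : ℕ) : gen (m + 2) (m + 1) = cupCap m := by rw [gen, if_pos rfl]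

/-- The block diagonal matrices: those whose entries at words of different heights vanish. -/
def IsBlock {n : ℕ} (M : Matrix (Word n) (Word n) K) : Prop := ∀ S T, wt S ≠ wt T → M S T = 0

theorem IsBlock.inc {n : ℕ} {M : Matrix (Word n) (Word n) K} (hM : IsBlock M) :
    IsBlock (inc n M) := by
  rintro (_ | ⟨S, a⟩) (_ | ⟨T, b⟩) h
  simp only [inc_snoc, ite_eq_right_iff]
  rintro rfl
  exact hM _ _ (by simpa [wt] using h)

theorem isBlock_cupCap (m : ℕ) : IsBlock (cupCap m) := by
  rintro (_ | ⟨_ | ⟨S, a⟩, b⟩) (_ | ⟨_ | ⟨T, c⟩, d⟩) h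
  rw [cupCap_snoc]
  split_ifs with h1 h2
  · rfl
  · subst h2
    cases a <;> cases b <;> cases c <;> cases d <;> simp_all [wt, eps]
  · rfl

theorem isBlock_gen (n i : ℕ) : IsBlock (gen n i) := by
  induction n with
  | zero => exact fun _ _ _ => rfl
  | succ n ih =>
    obtain _ | m := n
    · intro S T h
      rw [gen, diagonal_apply_ne]
      rintro rfl
      exact h rfl
    · rw [gen]
      split_ifs
      · exact isBlock_cupCap m
      · exact ih.inc

theorem cupCap_mul {m : ℕ} {ι : Type*} (N : Matrix (Word (m + 2)) ι K) (S : Word m) (a b : Bool)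
    (X : ι) :
    (cupCap m * N) ((S.snoc a).snoc b) X = if a = b then 0 else
      coef (wt S) a * (N ((S.snoc true).snoc false) X + N ((S.snoc false).snoc true) X) := by
  simp only [mul_apply, sum_snoc]
  by_cases h : a = b <;> simp [h, Finset.sum_add_distrib, mul_add]

theorem inc_cupCap_mul {m : ℕ} {ι : Type*} (N : Matrix (Word (m + 3)) ι K) (S : Word m)
    (a b c : Bool) (X : ι) :
    (inc (m + 2) (cupCap m) * N) (((S.snoc a).snoc b).snoc c) X = if a = b then 0 else
      coef (wt S) a * (N (((S.snoc true).snoc false).snoc c) X +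
        N (((S.snoc false).snoc true).snoc c) X) := by
  simp only [mul_apply, sum_snoc]
  by_cases h : a = b <;> cases c <;> simp [h, Finset.sum_add_distrib, mul_add]

theorem cupCap_mul_self (m : ℕ) : cupCap m * cupCap m = δ • cupCap m := by
  ext (_ | ⟨_ | ⟨S, a⟩, b⟩) (_ | ⟨_ | ⟨T, c⟩, d⟩)
  rw [← coef_add_coef (wt S), cupCap_mul, Matrix.smul_apply]
  by_cases h : a = b <;> by_cases h' : c = d <;> by_cases hS : S = T <;> simp [h, h', hS]
  ring

theorem cupCap_comm {m : ℕ} {M : Matrix (Word m) (Word m) K} (hM : IsBlock M) :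
    inc (m + 1) (inc m M) * cupCap m = cupCap m * inc (m + 1) (inc m M) := by
  ext (_ | ⟨_ | ⟨S, a⟩, b⟩) (_ | ⟨_ | ⟨T, c⟩, d⟩)
  rw [cupCap_mul]
  simp only [mul_apply, sum_snoc]
  by_cases h : wt S = wt T
  · cases a <;> cases b <;> cases c <;> cases d <;> simp [h, mul_comm]
  · cases a <;> cases b <;> cases c <;> cases d <;> simp [hM S T h]

theorem cupCap_braid₁ (m : ℕ) :
    inc (m + 2) (cupCap m) * cupCap (m + 1) * inc (m + 2) (cupCap m) = inc (m + 2) (cupCap m) := by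
  ext (_ | ⟨_ | ⟨_ | ⟨S, a⟩, b⟩, c⟩) X
  have h1 := coef_mul_coef (wt S) true
  have h2 := coef_mul_coef (wt S) false
  rw [mul_comm] at h1 h2
  obtain _ | ⟨_ | ⟨_ | ⟨T, d⟩, e⟩, f⟩ := X
  rw [mul_assoc, inc_cupCap_mul, cupCap_mul, cupCap_mul]
  simp only [inc_snoc, cupCap_snoc]
  by_cases hST : S = T
  · subst hST
    by_cases hde : d = e <;> by_cases hcf : c = f <;> cases a <;> cases b <;> cases c <;>
      simp_all [wt, eps]
  · simp [hST]

theorem cupCap_braid₂ (m : ℕ) :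
    cupCap (m + 1) * inc (m + 2) (cupCap m) * cupCap (m + 1) = cupCap (m + 1) := by
  ext (_ | ⟨_ | ⟨_ | ⟨S, a⟩, b⟩, c⟩) (_ | ⟨_ | ⟨_ | ⟨T, d⟩, e⟩, f⟩)
  have h1 := coef_mul_coef (wt S) true
  have h2 := coef_mul_coef (wt S) false
  rw [mul_assoc, cupCap_mul, inc_cupCap_mul, inc_cupCap_mul]
  simp only [cupCap_snoc, Word.snoc.injEq]
  by_cases hST : S = T
  · subst hST
    by_cases hef : e = f <;> cases a <;> cases b <;> cases c <;> cases d <;>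
      simp_all [wt, eps]
  · simp [hST]

theorem cupCap_sign : cupCap 0 * inc 1 (gen 1 0) * cupCap 0 = 0 := by
  ext (_ | ⟨_ | ⟨S, a⟩, b⟩) (_ | ⟨_ | ⟨T, c⟩, d⟩)
  cases S
  cases T
  rw [mul_assoc, cupCap_mul]
  simp only [mul_apply, sum_snoc, gen]
  cases c <;> cases d <;> simp [eps, diagonal, wt, coef, qsum_neg]

theorem gen_one_sq : gen 1 0 * gen 1 0 = 1 := by
  simp only [gen, diagonal_mul_diagonal, ← diagonal_one]
  congr 1
  ext (_ | ⟨_, a⟩)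
  cases a <;> simp [eps]

/-! ### Presentation of `TL(Bₙ)` -/

/-- The elements `g 0, …, g (n - 1)` satisfy the defining relations of `TL(Bₙ)`. -/
structure IsTLB {A : Type*} [Ring A] [Algebra K A] (n : ℕ) (g : ℕ → A) : Prop where
  Usq : ∀ i, 1 ≤ i → i < n → g i * g i = δ • g i
  braid₁ : ∀ i, 1 ≤ i → i + 1 < n → g i * g (i + 1) * g i = g i
  braid₂ : ∀ i, 1 ≤ i → i + 1 < n → g (i + 1) * g i * g (i + 1) = g (i + 1)
  comm : ∀ i j, i + 2 ≤ j → j < n → g i * g j = g j * g i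
  s0sq : 0 < n → g 0 * g 0 = 1
  UsU : 1 < n → g 1 * g 0 * g 1 = 0

theorem IsTLB.mono {A : Type*} [Ring A] [Algebra K A] {m n : ℕ} {g : ℕ → A} (h : IsTLB n g)
    (hmn : m ≤ n) : IsTLB m g where
  Usq i hi hm := h.Usq i hi (by omega)
  braid₁ i hi hm := h.braid₁ i hi (by omega)
  braid₂ i hi hm := h.braid₂ i hi (by omega)
  comm i j hi hm := h.comm i j hi (by omega)
  s0sq hm := h.s0sq (by omega)
  UsU hm := h.UsU (by omega)

theorem isTLB_gen (n : ℕ) : IsTLB n (gen n) := by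
  induction n with
  | zero => constructor <;> intros <;> omega
  | succ n ih =>
    obtain _ | m := n
    · refine ⟨?_, ?_, ?_, ?_, fun _ => gen_one_sq, ?_⟩ <;> intros <;> omega
    refine ⟨?_, ?_, ?_, ?_, ?_, ?_⟩
    · intro i hi hn
      obtain rfl | h := eq_or_ne i (m + 1)
      · rw [gen_last, cupCap_mul_self]
      · rw [gen_of_lt (by omega), ← map_mul, ih.Usq i hi (by omega), map_smul]
    · intro i hi hn
      obtain rfl | h := eq_or_ne i m
      · obtain ⟨m, rfl⟩ := Nat.exists_eq_add_of_le' hi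
        rw [gen_last, gen_of_lt (by omega), gen_last, cupCap_braid₁]
      · rw [gen_of_lt (n := m + 1) (i := i) (by omega),
          gen_of_lt (n := m + 1) (i := i + 1) (by omega), ← map_mul, ← map_mul,
          ih.braid₁ i hi (by omega)]
    · intro i hi hn
      obtain rfl | h := eq_or_ne i m
      · obtain ⟨m, rfl⟩ := Nat.exists_eq_add_of_le' hi
        rw [gen_last, gen_of_lt (by omega), gen_last, cupCap_braid₂]
      · rw [gen_of_lt (n := m + 1) (i := i) (by omega),
          gen_of_lt (n := m + 1) (i := i + 1) (by omega), ← map_mul, ← map_mul,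
          ih.braid₂ i hi (by omega)]
    · intro i j hij hn
      obtain rfl | h := eq_or_ne j (m + 1)
      · rw [gen_last, gen_of_lt (by omega), gen_of_lt (by omega), cupCap_comm (isBlock_gen _ _)]
      · rw [gen_of_lt (n := m + 1) (i := i) (by omega),
          gen_of_lt (n := m + 1) (i := j) (by omega), ← map_mul, ← map_mul,
          ih.comm i j hij (by omega)]
    · intro _
      rw [gen_of_lt (by omega), ← map_mul, ih.s0sq (by omega), map_one]
    · intro _
      obtain _ | m := m
      · rw [gen_last, gen_of_lt (by omega), cupCap_sign]
      · rw [gen_of_lt (n := m + 2) (i := 0) (by omega),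
          gen_of_lt (n := m + 2) (i := 1) (by omega), ← map_mul, ← map_mul, ih.UsU (by omega),
          map_zero]

/-- The `i`-th generator of `TL(Bₙ)`, or `0` if there is none. -/
def tgen (n i : ℕ) : TLB n :=
  if h : i < n then RingQuot.mkAlgHom K (TLBRel n) (FreeAlgebra.ι K ⟨i, h⟩) else 0

theorem tgen_of_lt {n i : ℕ} (h : i < n) :
    tgen n i = RingQuot.mkAlgHom K (TLBRel n) (FreeAlgebra.ι K ⟨i, h⟩) := dif_pos h

theorem isTLB_tgen (n : ℕ) : IsTLB n (tgen n) := by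
  refine ⟨?_, ?_, ?_, ?_, ?_, ?_⟩
  · intro i hi hn
    simpa [tgen_of_lt hn] using RingQuot.mkAlgHom_rel K (TLBRel.Usq ⟨i, hn⟩ hi)
  · intro i hi hn
    simpa [tgen_of_lt hn, tgen_of_lt (Nat.lt_of_succ_lt hn)] using
      RingQuot.mkAlgHom_rel K (TLBRel.braid₁ ⟨i, by omega⟩ ⟨i + 1, hn⟩ hi rfl)
  · intro i hi hn
    simpa [tgen_of_lt hn, tgen_of_lt (Nat.lt_of_succ_lt hn)] using
      RingQuot.mkAlgHom_rel K (TLBRel.braid₂ ⟨i, by omega⟩ ⟨i + 1, hn⟩ hi rfl)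
  · intro i j hij hn
    have hi : i < n := by omega
    obtain rfl | h := Nat.eq_zero_or_pos i
    · simpa [tgen_of_lt hn, tgen_of_lt hi] using
        RingQuot.mkAlgHom_rel K (TLBRel.s0comm ⟨0, hi⟩ ⟨j, hn⟩ rfl (by simpa using hij))
    · simpa [tgen_of_lt hn, tgen_of_lt hi] using
        RingQuot.mkAlgHom_rel K (TLBRel.Ucomm ⟨i, hi⟩ ⟨j, hn⟩ h hij)
  · intro hn
    simpa [tgen_of_lt hn] using RingQuot.mkAlgHom_rel K (TLBRel.s0sq ⟨0, hn⟩ rfl)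
  · intro hn
    simpa [tgen_of_lt hn, tgen_of_lt (Nat.lt_of_succ_lt hn)] using
      RingQuot.mkAlgHom_rel K (TLBRel.UsU ⟨0, by omega⟩ ⟨1, hn⟩ rfl rfl)

section Lift

variable {A : Type} [Ring A] [Algebra K A] {n : ℕ}

/-- The universal property of `TL(Bₙ)`. -/
def lift (g : ℕ → A) (h : IsTLB n g) : TLB n →ₐ[K] A :=
  RingQuot.liftAlgHom K ⟨FreeAlgebra.lift K fun i : Fin n => g i, by
    intro x y hxy
    cases hxy with
    | Usq i hi => simpa using h.Usq i hi i.2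
    | braid₁ i j hi hj =>
      have := h.braid₁ i hi (by omega)
      simpa [hj] using this
    | braid₂ i j hi hj =>
      have := h.braid₂ i hi (by omega)
      simpa [hj] using this
    | Ucomm i j hi hij => simpa using h.comm i j hij j.2
    | s0sq i hi =>
      have := h.s0sq (by omega)
      simpa [hi] using this
    | UsU i j hi hj =>
      have := h.UsU (by omega)
      simpa [hi, hj] using this
    | s0comm i j hi hj => simpa using h.comm i j (by omega) j.2⟩

theorem lift_tgen (g : ℕ → A) (h : IsTLB n g) {i : ℕ} (hi : i < n) :
    lift g h (tgen n i) = g i := by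
  simp [lift, tgen_of_lt hi]

theorem algHom_ext {f g : TLB n →ₐ[K] A} (h : ∀ i < n, f (tgen n i) = g (tgen n i)) : f = g := by
  apply RingQuot.ringQuot_ext'
  apply FreeAlgebra.hom_ext
  ext i
  simpa [tgen_of_lt i.2] using h i i.2

end Lift

theorem eq_top_of_tgen_mem {n : ℕ} (R : Subalgebra K (TLB n)) (h : ∀ i < n, tgen n i ∈ R) :
    R = ⊤ := by
  rw [eq_top_iff]
  intro x _
  obtain ⟨y, rfl⟩ := RingQuot.mkAlgHom_surjective K (TLBRel n) x
  induction y using FreeAlgebra.induction with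
  | grade0 r => rw [AlgHom.commutes]; exact R.algebraMap_mem r
  | grade1 i => rw [← tgen_of_lt i.2]; exact h i i.2
  | mul a b ha hb => rw [map_mul]; exact R.mul_mem (ha trivial) (hb trivial)
  | add a b ha hb => rw [map_add]; exact R.add_mem (ha trivial) (hb trivial)

theorem submodule_eq_top {n : ℕ} (Z : Submodule K (TLB n)) (h1 : 1 ∈ Z)
    (h : ∀ i < n, ∀ z ∈ Z, tgen n i * z ∈ Z) : Z = ⊤ := by
  let R : Subalgebra K (TLB n) :=
    { carrier := {x | ∀ z ∈ Z, x * z ∈ Z}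
      mul_mem' := fun {a b} ha hb z hz => by rw [mul_assoc]; exact ha _ (hb z hz)
      add_mem' := fun {a b} ha hb z hz => by rw [add_mul]; exact Z.add_mem (ha z hz) (hb z hz)
      algebraMap_mem' := fun r z hz => by
        rw [← Algebra.smul_def]; exact Z.smul_mem r hz }
  have hR : R = ⊤ := eq_top_of_tgen_mem R h
  rw [eq_top_iff]
  intro x _
  have hx : x ∈ R := hR ▸ Algebra.mem_top
  simpa using hx 1 h1

/-! ### The tower of algebras `TL(Bₙ)` -/

/-- The canonical map `TL(Bₙ) → TL(Bₙ₊₁)`. -/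
def up (n : ℕ) : TLB n →ₐ[K] TLB (n + 1) :=
  lift (tgen (n + 1)) ((isTLB_tgen (n + 1)).mono n.le_succ)

/-- The seminormal representation of `TL(Bₙ)`. -/
def rep (n : ℕ) : TLB n →ₐ[K] Matrix (Word n) (Word n) K := lift (gen n) (isTLB_gen n)

theorem up_tgen {n i : ℕ} (hi : i < n) : up n (tgen n i) = tgen (n + 1) i := lift_tgen _ _ hi

theorem rep_tgen {n i : ℕ} (hi : i < n) : rep n (tgen n i) = gen n i := lift_tgen _ _ hi

theorem rep_up {n : ℕ} (x : TLB n) : rep (n + 1) (up n x) = inc n (rep n x) := by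
  have h : (rep (n + 1)).comp (up n) = (inc n).comp (rep n) := algHom_ext fun i hi => by
    simp [up_tgen hi, rep_tgen hi, rep_tgen (hi.trans n.lt_succ_self), gen_of_lt hi]
  exact DFunLike.congr_fun h x

theorem isBlock_rep {n : ℕ} (x : TLB n) : IsBlock (rep n x) := by
  let R : Subalgebra K (TLB n) :=
    { carrier := {x | IsBlock (rep n x)}
      mul_mem' := fun {x y} hx hy S T h => by
        rw [map_mul, mul_apply]
        refine Finset.sum_eq_zero fun X _ => ?_
        by_cases hX : wt S = wt X
        · rw [hy X T (hX ▸ h), mul_zero]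
        · rw [hx S X hX, zero_mul]
      add_mem' := fun {x y} hx hy S T h => by
        rw [map_add, Matrix.add_apply, hx S T h, hy S T h, add_zero]
      algebraMap_mem' := fun r S T h => by
        rw [AlgHom.commutes, Matrix.algebraMap_matrix_apply, if_neg]
        rintro rfl
        exact h rfl }
  have hR : R = ⊤ := eq_top_of_tgen_mem R fun i hi S T h => by
    rw [rep_tgen hi]
    exact isBlock_gen n i S T h
  exact (hR ▸ Algebra.mem_top : x ∈ R)

/-- The last generator of `TL(B_{m+2})` commutes with the image of `TL(Bₘ)`. -/
theorem up_up_comm {m : ℕ} (x : TLB m) :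
    up (m + 1) (up m x) * tgen (m + 2) (m + 1) = tgen (m + 2) (m + 1) * up (m + 1) (up m x) := by
  have hR : (Subalgebra.centralizer K {tgen (m + 2) (m + 1)}).comap ((up (m + 1)).comp (up m)) =
      ⊤ := eq_top_of_tgen_mem _ fun i hi => by
    rw [Subalgebra.mem_comap, Subalgebra.mem_centralizer_iff]
    simp only [Set.mem_singleton_iff, forall_eq, AlgHom.comp_apply]
    rw [up_tgen hi, up_tgen (by omega), (isTLB_tgen (m + 2)).comm i _ (by omega) (by omega)]
  have hx : x ∈ (Subalgebra.centralizer K {tgen (m + 2) (m + 1)}).comap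
      ((up (m + 1)).comp (up m)) := hR ▸ Algebra.mem_top
  rw [Subalgebra.mem_comap, Subalgebra.mem_centralizer_iff] at hx
  exact (hx _ rfl).symm

/-- The span of `1`, `s₀` and the products `a U b`, where `U` is the last generator of
`TL(B_{m+2})` and `a`, `b` come from `TL(B_{m+1})`. -/
def sandwich (m : ℕ) : Submodule K (TLB (m + 2)) :=
  Submodule.span K ({1, tgen (m + 2) 0} ∪
    Set.range fun p : TLB (m + 1) × TLB (m + 1) =>
      up (m + 1) p.1 * tgen (m + 2) (m + 1) * up (m + 1) p.2)

theorem mul_mem_sandwich {m : ℕ} (a b : TLB (m + 1)) :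
    up (m + 1) a * tgen (m + 2) (m + 1) * up (m + 1) b ∈ sandwich m :=
  Submodule.subset_span (.inr ⟨(a, b), rfl⟩)

theorem exists_tgen_eq {m i : ℕ} (hi : 1 ≤ i) (him : i ≤ m + 1) :
    ∃ a b, tgen (m + 2) i = up (m + 1) a * tgen (m + 2) (m + 1) * up (m + 1) b := by
  induction him using Nat.decreasingInduction with
  | self => exact ⟨1, 1, by simp⟩
  | of_succ k hk ih =>
    obtain ⟨a, b, h⟩ := ih (by omega)
    refine ⟨tgen (m + 1) k * a, b * tgen (m + 1) k, ?_⟩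
    rw [← (isTLB_tgen (m + 2)).braid₁ k hi (by omega), h, map_mul, map_mul, up_tgen (by omega)]
    simp only [mul_assoc]

theorem sandwich_eq_top {m : ℕ}
    (hm : ∀ a : TLB (m + 1), ∃ c : TLB m,
      tgen (m + 2) (m + 1) * up (m + 1) a * tgen (m + 2) (m + 1) =
        up (m + 1) (up m c) * tgen (m + 2) (m + 1)) : sandwich m = ⊤ := by
  have h1 : 1 ∈ sandwich m := Submodule.subset_span (by simp)
  have hs : tgen (m + 2) 0 ∈ sandwich m := Submodule.subset_span (by simp)
  have hs' : up (m + 1) (tgen (m + 1) 0) = tgen (m + 2) 0 := up_tgen (by omega)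
  refine submodule_eq_top _ h1 fun i hi z hz => ?_
  refine Submodule.span_induction (p := fun z _ => tgen (m + 2) i * z ∈ sandwich m)
    ?_ (by simp) (fun x y _ _ hx hy => ?_) (fun r x _ hx => ?_) hz
  · rintro z ((rfl | rfl) | ⟨⟨a, b⟩, rfl⟩)
    · rw [mul_one]
      obtain rfl | h := Nat.eq_zero_or_pos i
      · exact hs
      · obtain ⟨a, b, h⟩ := exists_tgen_eq (m := m) h (by omega)
        rw [h]
        exact mul_mem_sandwich a b
    · obtain rfl | h := Nat.eq_zero_or_pos i
      · rw [(isTLB_tgen (m + 2)).s0sq (by omega)]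
        exact h1
      · obtain ⟨a, b, h⟩ := exists_tgen_eq (m := m) h (by omega)
        rw [h, ← hs', mul_assoc, ← map_mul]
        exact mul_mem_sandwich a _
    · obtain rfl | h := eq_or_ne i (m + 1)
      · obtain ⟨c, hc⟩ := hm a
        simp only [← mul_assoc]
        rw [hc]
        exact mul_mem_sandwich _ b
      · simp only [← mul_assoc]
        rw [← up_tgen (n := m + 1) (by omega), ← map_mul]
        exact mul_mem_sandwich _ b
  · rw [mul_add]
    exact Submodule.add_mem _ hx hy
  · rw [mul_smul_comm]
    exact Submodule.smul_mem _ r hx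

theorem span_tgen_one : Submodule.span K {1, tgen 1 0} = ⊤ := by
  refine submodule_eq_top _ (Submodule.subset_span (by simp)) fun i hi z hz => ?_
  obtain rfl : i = 0 := by omega
  rw [Submodule.mem_span_pair] at hz ⊢
  obtain ⟨a, b, rfl⟩ := hz
  exact ⟨b, a, by rw [mul_add, mul_smul_comm, mul_smul_comm, (isTLB_tgen 1).s0sq one_pos, mul_one,
    add_comm]⟩

/-- The existence of the conditional expectation from `TL(B_{m+1})` to `TL(Bₘ)`. -/
theorem exists_tgen_mul_mul_tgen (m : ℕ) (a : TLB (m + 1)) : ∃ c : TLB m,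
    tgen (m + 2) (m + 1) * up (m + 1) a * tgen (m + 2) (m + 1) =
      up (m + 1) (up m c) * tgen (m + 2) (m + 1) := by
  induction m with
  | zero =>
    have ha : a ∈ Submodule.span K {1, tgen 1 0} := span_tgen_one ▸ Submodule.mem_top
    rw [Submodule.mem_span_pair] at ha
    obtain ⟨x, y, rfl⟩ := ha
    have hU := (isTLB_tgen 2).Usq 1 le_rfl one_lt_two
    have hs := (isTLB_tgen 2).UsU one_lt_two
    refine ⟨algebraMap K _ (x * δ), ?_⟩
    have h0 : up 1 (tgen 1 0) = tgen 2 0 := up_tgen one_pos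
    change tgen 2 1 * up 1 (x • 1 + y • tgen 1 0) * tgen 2 1 = up 1 (up 0 _) * tgen 2 1
    rw [AlgHom.commutes, AlgHom.commutes, ← Algebra.smul_def]
    simp only [map_add, map_smul, map_one, h0, mul_add, add_mul,
      mul_smul_comm, smul_mul_assoc, hs, mul_one, hU, smul_zero, add_zero, smul_smul]
  | succ m ih =>
    have ht := isTLB_tgen (m + 3)
    have hU := ht.Usq (m + 2) (by omega) (by omega)
    have ha : a ∈ sandwich m := sandwich_eq_top ih ▸ Submodule.mem_top
    refine Submodule.span_induction (p := fun a _ => ∃ c : TLB (m + 1),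
      tgen (m + 3) (m + 2) * up (m + 2) a * tgen (m + 3) (m + 2) =
        up (m + 2) (up (m + 1) c) * tgen (m + 3) (m + 2)) ?_ ?_ ?_ ?_ ha
    · rintro z ((rfl | rfl) | ⟨⟨a, b⟩, rfl⟩)
      · refine ⟨algebraMap K _ δ, ?_⟩
        rw [AlgHom.commutes, AlgHom.commutes, ← Algebra.smul_def, map_one, mul_one, hU]
      · refine ⟨δ • tgen (m + 1) 0, ?_⟩
        rw [map_smul, map_smul, up_tgen (n := m + 1) (by omega), up_tgen (n := m + 2) (by omega),
          ← ht.comm 0 (m + 2) (by omega) (by omega), mul_assoc, hU, mul_smul_comm, smul_mul_assoc]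
      · refine ⟨a * b, ?_⟩
        rw [map_mul, map_mul, up_tgen (by omega), map_mul, map_mul]
        calc _ = (tgen (m + 3) (m + 2) * up (m + 2) (up (m + 1) a)) * tgen (m + 3) (m + 1) *
              (up (m + 2) (up (m + 1) b) * tgen (m + 3) (m + 2)) := by simp only [mul_assoc]
          _ = up (m + 2) (up (m + 1) a) * (tgen (m + 3) (m + 2) * tgen (m + 3) (m + 1) *
              tgen (m + 3) (m + 2)) * up (m + 2) (up (m + 1) b) := by
            rw [up_up_comm b, ← up_up_comm a]
            simp only [mul_assoc]
          _ = _ := by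
            rw [ht.braid₂ (m + 1) (by omega) (by omega), mul_assoc, ← up_up_comm b, mul_assoc]
    · exact ⟨0, by simp⟩
    · rintro x y _ _ ⟨c, hc⟩ ⟨d, hd⟩
      exact ⟨c + d, by simp only [map_add, mul_add, add_mul, hc, hd]⟩
    · rintro r x _ ⟨c, hc⟩
      exact ⟨r • c, by simp only [map_smul, mul_smul_comm, smul_mul_assoc, hc]⟩

/-! ### Faithfulness and density of the seminormal representation -/

/-- The pairs of words of equal height. -/
abbrev Pair (n : ℕ) : Type := {p : Word n × Word n // wt p.1 = wt p.2}

theorem IsBlock.eq_sum {n : ℕ} {M : Matrix (Word n) (Word n) K} (hM : IsBlock M) :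
    M = ∑ p : Pair n, M p.1.1 p.1.2 • single p.1.1 p.1.2 1 := by
  ext S T
  simp only [Matrix.sum_apply, Matrix.smul_apply, single_apply, smul_eq_mul, mul_ite, mul_one,
    mul_zero]
  by_cases h : wt S = wt T
  · rw [Finset.sum_eq_single ⟨(S, T), h⟩]
    · simp
    · rintro ⟨⟨S', T'⟩, h'⟩ _ hne
      rw [if_neg]
      rintro ⟨rfl, rfl⟩
      exact hne rfl
    · simp
  · rw [hM S T h, Finset.sum_eq_zero]
    rintro ⟨⟨S', T'⟩, h'⟩ _
    rw [if_neg]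
    rintro ⟨rfl, rfl⟩
    exact h h'

/-- The matrix units of the block diagonal matrices lie in the range of `rep`. -/
def HasUnits (n : ℕ) : Prop := ∀ S T : Word n, wt S = wt T → single S T 1 ∈ (rep n).range

theorem rep_injective_of_span {n : ℕ} (hn : HasUnits n) (v : Pair n → TLB n)
    (hv : Submodule.span K (Set.range v) = ⊤) : Function.Injective (rep n) := by
  let entries : TLB n →ₗ[K] (Pair n → K) :=
    LinearMap.pi fun p => (Matrix.entryLinearMap K K p.1.1 p.1.2).comp (rep n).toLinearMap
  have hent : Function.Surjective entries := by
    intro c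
    choose x hx using fun p : Pair n => hn p.1.1 p.1.2 p.2
    refine ⟨∑ p, c p • x p, ?_⟩
    have hx' : ∀ p, rep n (x p) = single p.1.1 p.1.2 1 := hx
    ext ⟨⟨S, T⟩, h⟩
    simp only [entries, LinearMap.pi_apply, LinearMap.comp_apply, AlgHom.toLinearMap_apply,
      map_sum, map_smul, hx', Matrix.entryLinearMap_apply, single_apply, smul_eq_mul]
    rw [Finset.sum_eq_single ⟨(S, T), h⟩]
    · simp
    · rintro ⟨⟨S', T'⟩, h'⟩ _ hne
      rw [if_neg, mul_zero]
      rintro ⟨rfl, rfl⟩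
      exact hne rfl
    · simp
  have hcomb : Function.Surjective (Fintype.linearCombination K v) := by
    rw [← LinearMap.range_eq_top, Fintype.range_linearCombination, hv]
  have hinj : Function.Injective (entries ∘ₗ Fintype.linearCombination K v) :=
    LinearMap.injective_iff_surjective.2 (hent.comp hcomb)
  have hent' : Function.Injective entries := by
    rw [LinearMap.coe_comp] at hinj
    exact hinj.of_comp_right hcomb
  intro x y hxy
  apply hent'
  ext p
  simp [entries, hxy]

theorem hasUnits_succ_succ {m : ℕ} (h : HasUnits (m + 1)) : HasUnits (m + 2) := by
  have hinc : ∀ S T : Word (m + 1), wt S = wt T →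
      inc (m + 1) (single S T 1) ∈ (rep (m + 2)).range := by
    intro S T hST
    obtain ⟨x, hx⟩ := h S T hST
    exact ⟨up (m + 1) x, by simpa [← hx] using rep_up x⟩
  have htop : cupCap m ∈ (rep (m + 2)).range :=
    ⟨tgen (m + 2) (m + 1), by simpa [gen_last] using rep_tgen (n := m + 2) (i := m + 1) (by omega)⟩
  have hmid : ∀ (X : Word m) (S T : Word (m + 2)), wt S = wt X → wt T = wt X →
      single S T 1 ∈ (rep (m + 2)).range := by
    rintro X (_ | ⟨S, a⟩) (_ | ⟨T, b⟩) hS hT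
    simp only [wt] at hS hT
    have h1 := hinc S (X.snoc !a) (by cases a <;> simp [wt, eps] at hS ⊢ <;> omega)
    have h2 := hinc (X.snoc !b) T (by cases b <;> simp [wt, eps] at hT ⊢ <;> omega)
    have h3 := Subalgebra.mul_mem _ (Subalgebra.mul_mem _ h1 htop) h2
    have h4 : inc (m + 1) (single S (X.snoc !a) 1) * cupCap m * inc (m + 1) (single (X.snoc !b) T 1)
        = coef (wt X) (!a) • single (S.snoc a) (T.snoc b) 1 := by
      simp only [inc_single, add_mul, mul_add, Matrix.single_mul_mul_single]
      cases a <;> cases b <;> simp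
    rw [h4] at h3
    have h5 := Subalgebra.smul_mem _ h3 (coef (wt X) (!a))⁻¹
    rwa [smul_smul, inv_mul_cancel₀ (coef_ne_zero _ _), one_smul] at h5
  intro S T hST
  obtain ⟨X, hX⟩ | ⟨a, rfl⟩ := exists_wt_eq_or_constWord S
  · exact hmid X S T hX.symm (hST ▸ hX.symm)
  obtain ⟨X, hX⟩ | ⟨b, rfl⟩ := exists_wt_eq_or_constWord T
  · exact absurd (hX.trans hST.symm) (wt_ne_wt_constWord X a)
  obtain rfl : a = b := by
    rw [wt_constWord, wt_constWord] at hST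
    cases a <;> cases b <;> simp [eps] at hST ⊢ <;> omega
  have h1 := hinc (constWord a (m + 1)) (constWord a (m + 1)) rfl
  have hwt : wt ((constWord a (m + 1)).snoc !a) = wt (constWord a m) := by
    cases a <;> simp [constWord, wt, eps]
  have h2 := hmid (constWord a m) _ _ hwt hwt
  have h3 := Subalgebra.sub_mem _ h1 h2
  rw [inc_single] at h3
  cases a <;> simpa [constWord] using h3

theorem span_units {n : ℕ} (hi : Function.Injective (rep n)) (e : Word n → Word n → TLB n)
    (he : ∀ S T, wt S = wt T → rep n (e S T) = single S T 1) :
    Submodule.span K (Set.range fun p : Pair n => e p.1.1 p.1.2) = ⊤ := by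
  rw [eq_top_iff]
  intro x _
  have hx : x = ∑ p : Pair n, rep n x p.1.1 p.1.2 • e p.1.1 p.1.2 := by
    apply hi
    rw [map_sum]
    simp only [map_smul]
    conv_lhs => rw [(isBlock_rep x).eq_sum]
    exact Finset.sum_congr rfl fun p _ => by rw [he _ _ p.2]
  rw [hx]
  exact Submodule.sum_mem _ fun p _ => Submodule.smul_mem _ _ (Submodule.subset_span ⟨p, rfl⟩)

theorem rep_injective_succ_succ {m : ℕ} (hm : HasUnits m) (hm' : HasUnits (m + 1))
    (hi' : Function.Injective (rep (m + 1))) : Function.Injective (rep (m + 2)) := by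
  have ex : ∀ S T : Word m, ∃ x, wt S = wt T → rep m x = single S T 1 := fun S T => by
    by_cases h : wt S = wt T
    · obtain ⟨x, hx⟩ := hm S T h
      exact ⟨x, fun _ => hx⟩
    · exact ⟨0, fun h' => absurd h' h⟩
  have ex' : ∀ S T : Word (m + 1), ∃ x, wt S = wt T → rep (m + 1) x = single S T 1 := fun S T => by
    by_cases h : wt S = wt T
    · obtain ⟨x, hx⟩ := hm' S T h
      exact ⟨x, fun _ => hx⟩
    · exact ⟨0, fun h' => absurd h' h⟩
  choose d hd using ex
  choose e he using ex'
  have e_mul_d : ∀ (S : Word (m + 1)) (X Y : Word m) (a : Bool), wt S = wt X + eps a →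
      wt X = wt Y → e S (X.snoc a) * up m (d X Y) = e S (Y.snoc a) := by
    intro S X Y a hS hX
    apply hi'
    rw [map_mul, rep_up, hd X Y hX, he _ _ (by simpa [wt] using hS),
      he _ _ (by simpa [wt, ← hX] using hS), inc_single]
    cases a <;> simp [mul_add]
  have d_mul_e : ∀ (T : Word (m + 1)) (X Y : Word m) (a : Bool), wt T = wt X + eps a →
      wt X = wt Y → up m (d X Y) * e (Y.snoc a) T = e (X.snoc a) T := by
    intro T X Y a hT hX
    apply hi'
    rw [map_mul, rep_up, hd X Y hX, he (X.snoc a) T (by simp [wt, hT]),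
      he (Y.snoc a) T (by simp [wt, ← hX, hT]), inc_single]
    cases a <;> simp [add_mul]
  have d_mul_e_of_ne : ∀ (T : Word (m + 1)) (X Y : Word m) (a : Bool), wt T = wt Y + eps a →
      X ≠ Y → up m (d X X) * e (Y.snoc a) T = 0 := by
    intro T X Y a hT hX
    apply hi'
    rw [map_mul, rep_up, hd X X rfl, he _ _ (by simpa [wt] using hT.symm), inc_single, map_zero]
    cases a <;> simp [add_mul, hX]
  let U := tgen (m + 2) (m + 1)
  let v : Pair (m + 2) → TLB (m + 2) := fun
    | ⟨(.snoc S a, .snoc T b), _⟩ =>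
      if h : ∃ X : Word m, wt X = wt S + eps a then
        up (m + 1) (e S (h.choose.snoc !a)) * U * up (m + 1) (e (h.choose.snoc !b) T)
      else if a then 1 else tgen (m + 2) 0
  refine rep_injective_of_span (hasUnits_succ_succ hm') v ?_
  have hconst : ∀ a, ¬ ∃ X : Word m, wt X = wt (constWord a (m + 1)) + eps a :=
    fun a ⟨X, hX⟩ => wt_ne_wt_constWord X a hX
  rw [eq_top_iff, ← sandwich_eq_top (exists_tgen_mul_mul_tgen m), sandwich, Submodule.span_le]
  rintro z ((rfl | rfl) | ⟨⟨x, y⟩, rfl⟩)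
  · exact Submodule.subset_span ⟨⟨(constWord true _, constWord true _), rfl⟩, dif_neg (hconst true)⟩
  · exact Submodule.subset_span
      ⟨⟨(constWord false _, constWord false _), rfl⟩, dif_neg (hconst false)⟩
  · have hx : x ∈ Submodule.span K (Set.range fun p : Pair (m + 1) => e p.1.1 p.1.2) :=
      span_units hi' e he ▸ Submodule.mem_top
    have hy : y ∈ Submodule.span K (Set.range fun p : Pair (m + 1) => e p.1.1 p.1.2) :=
      span_units hi' e he ▸ Submodule.mem_top
    refine Submodule.span_induction₂
      (p := fun x y _ _ => up (m + 1) x * U * up (m + 1) y ∈ Submodule.span K (Set.range v))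
      ?_ (by simp) (by simp) ?_ ?_ ?_ ?_ hx hy
    · rintro _ _ ⟨⟨⟨S, _ | ⟨X, a⟩⟩, hS⟩, rfl⟩ ⟨⟨⟨_ | ⟨Y, b⟩, T⟩, hT⟩, rfl⟩
      simp only [wt] at hS hT ⊢
      have key : ∀ Z : Word m, wt X = wt Z →
          up (m + 1) (e S (X.snoc a)) * U * up (m + 1) (e (Y.snoc b) T) =
            up (m + 1) (e S (Z.snoc a)) * U * up (m + 1) (up m (d Z X) * e (Y.snoc b) T) := by
        intro Z hZ
        rw [← e_mul_d S Z X a (by rw [hS, hZ]) hZ.symm, map_mul, map_mul, mul_assoc (up _ _),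
          up_up_comm]
        simp only [U, mul_assoc]
      by_cases hXY : X = Y
      · subst hXY
        have h : ∃ Z : Word m, wt Z = wt S + eps (!a) :=
          ⟨X, by cases a <;> simp [eps] at hS ⊢ <;> omega⟩
        have hZ : wt X = wt h.choose := by
          rw [h.choose_spec]
          cases a <;> simp [eps] at hS ⊢ <;> omega
        rw [key _ hZ, d_mul_e T _ X b (by rw [← hT, hZ]) hZ.symm]
        refine Submodule.subset_span ⟨⟨(S.snoc !a, T.snoc !b), ?_⟩, ?_⟩
        · simp only [wt, hS, ← hT]
          cases a <;> cases b <;> simp [eps]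
        · simp only [v, dif_pos h, Bool.not_not]
      · rw [key X rfl, d_mul_e_of_ne T X Y b hT.symm hXY, map_zero, mul_zero]
        exact Submodule.zero_mem _
    · intro x y z _ _ _ hx hy
      rw [map_add, add_mul, add_mul]
      exact Submodule.add_mem _ hx hy
    · intro x y z _ _ _ hx hy
      rw [map_add, mul_add]
      exact Submodule.add_mem _ hx hy
    · intro r x y _ _ hx
      rw [map_smul, smul_mul_assoc, smul_mul_assoc]
      exact Submodule.smul_mem _ r hx
    · intro r x y _ _ hx
      rw [map_smul, mul_smul_comm]
      exact Submodule.smul_mem _ r hx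

theorem hasUnits_zero : HasUnits 0 := by
  rintro ⟨⟩ ⟨⟩ _
  refine ⟨1, ?_⟩
  ext ⟨⟩ ⟨⟩
  simp

theorem hasUnits_one : HasUnits 1 := by
  rintro (_ | ⟨⟨⟩, a⟩) (_ | ⟨⟨⟩, b⟩) h
  obtain rfl : a = b := by
    cases a <;> cases b <;> simp [wt, eps] at h ⊢
  refine ⟨(1 / 2 : K) • (1 + (eps a : K) • tgen 1 0), ?_⟩
  simp only [AlgHom.toRingHom_eq_coe, RingHom.coe_coe, map_smul, map_add, map_one,
    rep_tgen one_pos, gen]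
  ext (_ | ⟨⟨⟩, b⟩) (_ | ⟨⟨⟩, c⟩)
  cases a <;> cases b <;> cases c <;>
    simp [eps, diagonal, one_apply] <;> norm_num

theorem hasUnits (n : ℕ) : HasUnits n := by
  induction n with
  | zero => exact hasUnits_zero
  | succ n ih =>
    obtain _ | m := n
    · exact hasUnits_one
    · exact hasUnits_succ_succ ih

theorem rep_injective (n : ℕ) : Function.Injective (rep n) := by
  induction n with
  | zero =>
    refine rep_injective_of_span hasUnits_zero (fun _ => 1) ?_
    exact submodule_eq_top _ (Submodule.subset_span ⟨⟨(.nil, .nil), rfl⟩, rfl⟩) fun i hi => by omega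
  | succ n ih =>
    obtain _ | m := n
    · refine rep_injective_of_span hasUnits_one
        (fun p => if p.1.1 = .snoc .nil true then 1 else tgen 1 0) ?_
      rw [eq_top_iff, ← span_tgen_one, Submodule.span_le]
      rintro z (rfl | rfl)
      · exact Submodule.subset_span ⟨⟨(.snoc .nil true, .snoc .nil true), rfl⟩, if_pos rfl⟩
      · exact Submodule.subset_span ⟨⟨(.snoc .nil false, .snoc .nil false), rfl⟩, by simp⟩
    · exact rep_injective_succ_succ (hasUnits m) (hasUnits (m + 1)) ih

theorem mem_range_rep {n : ℕ} {M : Matrix (Word n) (Word n) K} :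
    M ∈ (rep n).range ↔ IsBlock M := by
  refine ⟨?_, fun hM => ?_⟩
  · rintro ⟨x, rfl⟩
    exact isBlock_rep x
  · rw [hM.eq_sum]
    exact Subalgebra.sum_mem _ fun p _ => Subalgebra.smul_mem _ (hasUnits n _ _ p.2) _

/-! ### Diagonalisation of `Bop` -/

/-- The coefficient of the letter `b` in the last tensor factor of the eigenvector attached to
a path with last step `a` starting at height `k`. -/
def letterCoef (k : ℤ) (a b : Bool) : K := if b then eps a * q ^ (eps a * k) else 1

/-- The eigenvectors of `Bop n`; they are pure tensors. -/
def eigvec : {n : ℕ} → Word n → W n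
  | _, .nil => fun _ => 1
  | _, .snoc S a => fun u => eigvec S (Fin.init u) * letterCoef (wt S) a (u (Fin.last _))

theorem Bop_succ (n : ℕ) (F : W (n + 1)) (u : Fin n → Bool) (b : Bool) :
    Bop (n + 1) F (Fin.snoc u b) =
      q ^ eps b * Bop n (fun w => F (Fin.snoc w b)) u + F (Fin.snoc u !b) := by
  simp only [Bop, LinearMap.coe_mk, AddHom.coe_mk]
  rw [Fin.sum_univ_castSucc, Finset.mul_sum]
  congr 1
  · refine Finset.sum_congr rfl fun i _ => ?_
    rw [← mul_assoc]
    congr 1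
    · rw [Finset.prod_filter, Finset.prod_filter, Fin.prod_univ_castSucc]
      simp [Fin.castSucc_lt_last, mul_comm]
    · congr 1
      simp [flipLetter, ← Fin.snoc_update]
  · rw [Finset.prod_eq_one, one_mul]
    · simp [flipLetter, Fin.update_snoc_last]
    · intro j hj
      exact absurd (Finset.mem_filter.1 hj).2 (Fin.le_last j).not_gt

theorem Bop_eigvec {n : ℕ} (S : Word n) : Bop n (eigvec S) = qint (wt S) • eigvec S := by
  induction S with
  | nil => ext u; simp [Bop, wt, qint]
  | @snoc n S a ih =>
    ext u
    obtain ⟨u, b, rfl⟩ : ∃ (w : Fin n → Bool) (b : Bool), u = Fin.snoc w b :=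
      ⟨Fin.init u, u (Fin.last n), (Fin.snoc_init_self u).symm⟩
    have h1 : (fun w : Fin n → Bool => eigvec (S.snoc a) (Fin.snoc w b)) =
        letterCoef (wt S) a b • eigvec S := by
      ext w
      simp [eigvec, mul_comm]
    have h2 : q ^ eps b * qint (wt S) * letterCoef (wt S) a b + letterCoef (wt S) a (!b) =
        qint (wt S + eps a) * letterCoef (wt S) a b := by
      have := q_ne_zero
      have := zpow_ne_zero (wt S) q_ne_zero
      have := q_sub_inv_ne_zero
      rw [qint, qint, div_mul_eq_mul_div, mul_div_assoc', div_mul_eq_mul_div, div_add' _ _ _ this]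
      congr 1
      cases a <;> cases b <;>
        simp [letterCoef, eps, zpow_add₀ q_ne_zero, zpow_neg] <;> field_simp <;> ring
    rw [Bop_succ, h1, map_smul, ih]
    simp only [eigvec, Pi.smul_apply, smul_eq_mul, Fin.init_snoc, Fin.snoc_last, wt]
    linear_combination eigvec S u * h2

theorem linearIndependent_eigvec (n : ℕ) : LinearIndependent K (eigvec (n := n)) := by
  rw [Fintype.linearIndependent_iff]
  induction n with
  | zero =>
    rintro c hc ⟨⟩
    have := congrFun hc Fin.elim0
    rw [Fintype.sum_eq_single Word.nil fun S h => (h (by cases S; rfl)).elim] at this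
    simpa [eigvec] using this
  | succ n ih =>
    intro c hc
    have h : ∀ (b : Bool) (S : Word n), c (S.snoc true) * letterCoef (wt S) true b +
        c (S.snoc false) * letterCoef (wt S) false b = 0 := by
      intro b
      refine ih _ ?_
      ext u
      have := congrFun hc (Fin.snoc u b)
      simp only [sum_snoc, eigvec, Finset.sum_apply, Pi.smul_apply, smul_eq_mul,
        Fin.init_snoc, Fin.snoc_last, Pi.zero_apply] at this ⊢
      rw [← this]
      exact Finset.sum_congr rfl fun S _ => by ring
    rintro (_ | ⟨S, a⟩)
    have h1 := h false S
    have h2 := h true S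
    simp only [letterCoef, eps, if_true, Bool.false_eq_true, if_false, Int.cast_one, Int.cast_neg,
      one_mul, mul_one, neg_mul] at h1 h2
    have h3 : c (S.snoc true) * qsum (wt S) = 0 := by
      rw [qsum]
      linear_combination h2 + q ^ (-wt S) * h1
    have h4 : c (S.snoc true) = 0 := (mul_eq_zero.1 h3).resolve_right (qsum_ne_zero _)
    cases a
    · simpa [h4] using h1
    · exact h4

/-- The basis of eigenvectors of `Bop n`. -/
def eigBasis (n : ℕ) : Module.Basis (Word n) K (W n) :=
  haveI : Nonempty (Word n) := ⟨constWord true n⟩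
  basisOfLinearIndependentOfCardEqFinrank (linearIndependent_eigvec n) (by simp [card_word])

theorem eigBasis_apply {n : ℕ} (S : Word n) : eigBasis n S = eigvec S := by
  simp [eigBasis]

theorem toMatrix_Bop (n : ℕ) :
    LinearMap.toMatrixAlgEquiv (eigBasis n) (Bop n) = diagonal fun S => qint (wt S) := by
  ext S T
  rw [LinearMap.toMatrixAlgEquiv_apply, eigBasis_apply, Bop_eigvec, map_smul, ← eigBasis_apply,
    Module.Basis.repr_self, Finsupp.smul_apply, Finsupp.single_apply, Matrix.diagonal_apply]
  by_cases h : S = T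
  · simp [h]
  · simp [h, Ne.symm h]

theorem mem_centralizer_Bop {n : ℕ} (A : Module.End K (W n)) :
    A ∈ Subalgebra.centralizer K {Bop n} ↔
      IsBlock (LinearMap.toMatrixAlgEquiv (eigBasis n) A) := by
  rw [Subalgebra.mem_centralizer_iff]
  simp only [Set.mem_singleton_iff, forall_eq]
  rw [← (LinearMap.toMatrixAlgEquiv (eigBasis n)).injective.eq_iff, map_mul, map_mul, toMatrix_Bop,
    ← Matrix.ext_iff]
  simp only [Matrix.diagonal_mul, Matrix.mul_diagonal]
  refine forall₂_congr fun S T => ?_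
  rw [mul_comm, mul_eq_mul_left_iff, qint_injective.eq_iff, or_iff_not_imp_left]

end TypeBTL

/-- For every `n ≥ 1` there is a `K`-algebra isomorphism between the type
`B` Temperley–Lieb algebra `TL(Bₙ)` and the centralizer of `B` in the endomorphism algebra of
`W n = V^{⊗n}` (the endomorphism algebra of `V^{⊗n}` over the coideal subalgebra
`U_q'(gl₁ × gl₁)`). -/
theorem stmt_10 (n : ℕ) (hn : 1 ≤ n) :
    Nonempty
      (TLB n ≃ₐ[K]
        (Subalgebra.centralizer K {Bop n} : Subalgebra K (Module.End K (W n)))) := by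
  let Φ : TLB n →ₐ[K] Module.End K (W n) :=
    (LinearMap.toMatrixAlgEquiv (TypeBTL.eigBasis n)).symm.toAlgHom.comp (TypeBTL.rep n)
  have hΦ : Function.Injective Φ :=
    (LinearMap.toMatrixAlgEquiv (TypeBTL.eigBasis n)).symm.injective.comp (TypeBTL.rep_injective n)
  have hrange : Φ.range = Subalgebra.centralizer K {Bop n} := by
    ext A
    rw [TypeBTL.mem_centralizer_Bop, ← TypeBTL.mem_range_rep]
    exact exists_congr fun x =>
      (LinearMap.toMatrixAlgEquiv (TypeBTL.eigBasis n)).toEquiv.symm_apply_eq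
  exact ⟨(AlgEquiv.ofInjective Φ hΦ).trans (Subalgebra.equivOfEq _ _ hrange)⟩
end
end

section
/- Let n ≥ 1. For each sign ε ∈ {+1, −1} there exists a unique element b ∈ TL(B_n) such that b ≠ 0, b² = b, s_0·b = ε·b = b·s_0, and U_i·b = 0 = b·U_i for all 1 ≤ i ≤ n−1. -/
noncomputable section

/-- The generator of `TL(Bₙ)` with index `i`: `g n 0 = s₀`, and `g n i = Uᵢ` for
`1 ≤ i ≤ n-1` (indices out of range are sent to `0`). -/
noncomputable def g (n : ℕ) (i : ℕ) : TLB n :=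
  if h : i < n then RingQuot.mkAlgHom K (TLBRel n) (FreeAlgebra.ι K ⟨i, h⟩) else 0

/-- `IsJW n ε b` says that `b` is a type `B` Jones–Wenzl projector of sign `ε` in `TL(Bₙ)`:
`b` is a nonzero idempotent with `s₀·b = ε·b = b·s₀` and `Uᵢ·b = 0 = b·Uᵢ` for all
`1 ≤ i ≤ n-1`.  For `ε = 1` this characterizes `b_{n,+}` and for `ε = -1` it characterizes
`b_{n,-}`. -/
def IsJW (n : ℕ) (ε : K) (b : TLB n) : Prop :=
  b ≠ 0 ∧ b * b = b ∧ g n 0 * b = ε • b ∧ b * g n 0 = ε • b ∧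
    ∀ i : ℕ, 1 ≤ i → i ≤ n - 1 → g n i * b = 0 ∧ b * g n i = 0

/-! ### Wenzl's recursion in an arbitrary algebra -/

section Recursion

variable {F A : Type*} [Field F] [Ring A] [Algebra F A] {d e u : A} {c : F}

/-- The recursion producing the next Jones–Wenzl projector from the projector `e`. -/
def wenzlStep (c : F) (e u : A) : A := e - c • (e * u * e)

theorem mul_wenzlStep_of_mul_eq {x : A} {a : F} (h : x * e = a • e) :
    x * wenzlStep c e u = a • wenzlStep c e u := by
  simp only [wenzlStep, mul_sub, mul_smul_comm, ← mul_assoc, h, smul_mul_assoc, smul_sub,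
    smul_comm a c]

theorem wenzlStep_mul_of_mul_eq {x : A} {a : F} (h : e * x = a • e) :
    wenzlStep c e u * x = a • wenzlStep c e u := by
  simp only [wenzlStep, sub_mul, mul_smul_comm, mul_assoc, h, smul_mul_assoc, smul_sub,
    smul_comm a c]

theorem mul_wenzlStep (hde : d * e = e) (hdu : Commute d u) (hc : c • (u * e * u) = d * u) :
    u * wenzlStep c e u = 0 := by
  have h : c • (u * (e * u * e)) = u * e := by
    rw [← mul_assoc, ← mul_assoc, ← smul_mul_assoc, hc, hdu.eq, mul_assoc, hde]
  rw [wenzlStep, mul_sub, mul_smul_comm, h, sub_self]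

theorem wenzlStep_mul (hed : e * d = e) (hc : c • (u * e * u) = d * u) :
    wenzlStep c e u * u = 0 := by
  have h : c • (e * u * e * u) = e * u := by
    rw [mul_assoc e, mul_assoc e, ← mul_smul_comm, hc, ← mul_assoc, hed]
  rw [wenzlStep, sub_mul, smul_mul_assoc, h, sub_self]

theorem wenzlStep_isIdempotentElem (he : IsIdempotentElem e) (h : wenzlStep c e u * u = 0) :
    IsIdempotentElem (wenzlStep c e u) := by
  have hfe : wenzlStep c e u * e = wenzlStep c e u := by
    simpa using wenzlStep_mul_of_mul_eq (c := c) (u := u) (a := 1) (by simpa using he.eq)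
  calc wenzlStep c e u * wenzlStep c e u
      = wenzlStep c e u * e - c • (wenzlStep c e u * e * u * e) := by
        nth_rewrite 2 [wenzlStep]
        simp only [mul_sub, mul_smul_comm, mul_assoc]
    _ = wenzlStep c e u := by rw [hfe, h, zero_mul, smul_zero, sub_zero]

/-- The partial trace identity for the next projector, for the neighbouring generator `v`. -/
theorem mul_wenzlStep_mul {v : A} {a : F} (he : IsIdempotentElem e) (hev : Commute e v)
    (hv : v * v = a • v) (hvuv : v * u * v = v) :
    v * wenzlStep c e u * v = (a - c) • (e * v) := by
  have h₁ : v * e * v = a • (e * v) := by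
    rw [← hev.eq, mul_assoc, hv, mul_smul_comm]
  have h₂ : v * (e * u * e) * v = e * v := by
    calc v * (e * u * e) * v = (v * e) * u * (e * v) := by simp only [mul_assoc]
      _ = (e * v) * u * (v * e) := by rw [hev.eq]
      _ = e * (v * u * v) * e := by simp only [mul_assoc]
      _ = e * v := by rw [hvuv, hev.eq, mul_assoc, he.eq]
  rw [wenzlStep, mul_sub, sub_mul, mul_smul_comm, smul_mul_assoc, h₁, h₂, sub_smul]

end Recursion

/-! ### The coefficients of the recursion -/

/-- `qSum k = q ^ k + q ^ (-k)`. -/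
def qSum (k : ℕ) : K := q ^ k + (q ^ k)⁻¹

theorem q_ne_zero : q ≠ 0 := RatFunc.X_ne_zero

theorem qSum_ne_zero (k : ℕ) : qSum k ≠ 0 := by
  have hq : q ^ k ≠ 0 := pow_ne_zero _ q_ne_zero
  intro h
  have h₁ : q ^ k * q ^ k + 1 = 0 := by
    rw [← mul_inv_cancel₀ hq, ← mul_add]
    exact mul_eq_zero_of_right _ h
  have h₂ : algebraMap (Polynomial ℂ) K (Polynomial.X ^ k * Polynomial.X ^ k + 1) = 0 := by
    simpa [q] using h₁
  have h₃ := congrArg (Polynomial.eval 1)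
    ((map_eq_zero_iff _ (RatFunc.algebraMap_injective ℂ)).1 h₂)
  norm_num at h₃

theorem delta_mul_qSum (k : ℕ) : δ * qSum (k + 1) = qSum (k + 2) + qSum k := by
  have hq := q_ne_zero
  simp only [δ, qSum]
  field_simp
  ring

theorem delta_sub_div (k : ℕ) :
    δ - qSum k / qSum (k + 1) = qSum (k + 2) / qSum (k + 1) := by
  have h := qSum_ne_zero (k + 1)
  field_simp
  linear_combination delta_mul_qSum k

/-! ### Relations between the generators -/

section Relations

variable {n : ℕ}

theorem g_of_lt {i : ℕ} (h : i < n) :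
    g n i = RingQuot.mkAlgHom K (TLBRel n) (FreeAlgebra.ι K ⟨i, h⟩) := dif_pos h

theorem g_of_ge {i : ℕ} (h : n ≤ i) : g n i = 0 := dif_neg h.not_gt

theorem g_mul_self {i : ℕ} (hi : 1 ≤ i) : g n i * g n i = δ • g n i := by
  rcases lt_or_ge i n with h | h
  · simpa only [g_of_lt h, map_mul, map_smul] using
      RingQuot.mkAlgHom_rel K (TLBRel.Usq (⟨i, h⟩ : Fin n) hi)
  · simp [g_of_ge h]

theorem g_succ_mul_g_mul_g_succ {i : ℕ} (hi : 1 ≤ i) :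
    g n (i + 1) * g n i * g n (i + 1) = g n (i + 1) := by
  rcases lt_or_ge (i + 1) n with h | h
  · have h' : i < n := by omega
    simpa only [g_of_lt h, g_of_lt h', map_mul] using
      RingQuot.mkAlgHom_rel K (TLBRel.braid₂ (⟨i, h'⟩ : Fin n) ⟨i + 1, h⟩ hi rfl)
  · simp [g_of_ge h]

theorem g_commute {i j : ℕ} (h : i + 2 ≤ j) : Commute (g n i) (g n j) := by
  rcases lt_or_ge j n with hj | hj
  · have hi : i < n := by omega
    rw [Commute, SemiconjBy, g_of_lt hj, g_of_lt hi, ← map_mul, ← map_mul]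
    rcases Nat.eq_zero_or_pos i with h0 | h0
    · exact RingQuot.mkAlgHom_rel K
        (TLBRel.s0comm (⟨i, hi⟩ : Fin n) ⟨j, hj⟩ h0 (by simp only; omega))
    · exact RingQuot.mkAlgHom_rel K (TLBRel.Ucomm (⟨i, hi⟩ : Fin n) ⟨j, hj⟩ h0 h)
  · simp [g_of_ge hj]

theorem g_zero_mul_self (hn : 1 ≤ n) : g n 0 * g n 0 = 1 := by
  have h : 0 < n := hn
  simpa only [g_of_lt h, map_mul, map_one] using
    RingQuot.mkAlgHom_rel K (TLBRel.s0sq (⟨0, h⟩ : Fin n) rfl)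

theorem g_one_mul_g_zero_mul_g_one : g n 1 * g n 0 * g n 1 = 0 := by
  rcases lt_or_ge 1 n with h | h
  · have h' : 0 < n := by omega
    simpa only [g_of_lt h, g_of_lt h', map_mul, map_zero] using
      RingQuot.mkAlgHom_rel K (TLBRel.UsU (⟨0, h'⟩ : Fin n) ⟨1, h⟩ rfl rfl)
  · simp [g_of_ge h]

end Relations

/-! ### The character `s₀ ↦ ε`, `Uᵢ ↦ 0` -/

section Character

variable {n : ℕ} {ε : K}

/-- The one-dimensional representation of `TL(Bₙ)` with `s₀ ↦ ε` and `Uᵢ ↦ 0`. -/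
def signChar (n : ℕ) (hε : ε * ε = 1) : TLB n →ₐ[K] K :=
  RingQuot.liftAlgHom K ⟨FreeAlgebra.lift K fun i : Fin n ↦ if (i : ℕ) = 0 then ε else 0, by
    intro x y h
    induction h with
    | Usq i hi => simp [Nat.one_le_iff_ne_zero.1 hi]
    | braid₁ i j hi hj => simp [Nat.one_le_iff_ne_zero.1 hi]
    | braid₂ i j hi hj => simp [hj]
    | Ucomm i j hi h => simp [Nat.one_le_iff_ne_zero.1 hi]
    | s0sq i hi => simp [hi, hε]
    | UsU i j hi hj => simp [hj]
    | s0comm i j hi h => simp [mul_comm]⟩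

theorem signChar_ι (hε : ε * ε = 1) (i : Fin n) :
    signChar n hε (RingQuot.mkAlgHom K (TLBRel n) (FreeAlgebra.ι K i)) =
      if (i : ℕ) = 0 then ε else 0 := by
  simp [signChar]

theorem signChar_g_zero (hε : ε * ε = 1) (hn : 1 ≤ n) : signChar n hε (g n 0) = ε := by
  rw [g_of_lt (show 0 < n from hn), signChar_ι, if_pos rfl]

theorem signChar_g {i : ℕ} (hε : ε * ε = 1) (hi : 1 ≤ i) : signChar n hε (g n i) = 0 := by
  rcases lt_or_ge i n with h | h
  · rw [g_of_lt h, signChar_ι, if_neg (by simp only; omega)]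
  · simp [g_of_ge h]

/-- `TL(Bₙ)` is generated by the elements `g n i`. -/
theorem tlb_induction {p : TLB n → Prop} (halg : ∀ a : K, p (algebraMap K _ a))
    (hg : ∀ i < n, p (g n i)) (hmul : ∀ x y, p x → p y → p (x * y))
    (hadd : ∀ x y, p x → p y → p (x + y)) (x : TLB n) : p x := by
  obtain ⟨x, rfl⟩ := RingQuot.mkAlgHom_surjective K (TLBRel n) x
  induction x using FreeAlgebra.induction with
  | grade0 a => simpa only [AlgHom.commutes] using halg a
  | grade1 i => simpa only [g_of_lt i.2] using hg i i.2
  | mul x y hx hy => simpa only [map_mul] using hmul _ _ hx hy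
  | add x y hx hy => simpa only [map_add] using hadd _ _ hx hy

theorem mul_eq_signChar_smul (hε : ε * ε = 1) (hn : 1 ≤ n) {b : TLB n}
    (h0 : g n 0 * b = ε • b) (hi : ∀ i, 1 ≤ i → i ≤ n - 1 → g n i * b = 0) (x : TLB n) :
    x * b = signChar n hε x • b := by
  induction x using tlb_induction with
  | halg a => rw [AlgHom.commutes, Algebra.smul_def, Algebra.algebraMap_self_apply]
  | hg i hin =>
    rcases Nat.eq_zero_or_pos i with rfl | h
    · rw [h0, signChar_g_zero hε hn]
    · rw [hi i h (by omega), signChar_g hε h, zero_smul]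
  | hmul x y hx hy => rw [mul_assoc, hy, mul_smul_comm, hx, smul_smul, map_mul, mul_comm]
  | hadd x y hx hy => rw [add_mul, hx, hy, map_add, add_smul]

theorem mul_eq_signChar_smul' (hε : ε * ε = 1) (hn : 1 ≤ n) {b : TLB n}
    (h0 : b * g n 0 = ε • b) (hi : ∀ i, 1 ≤ i → i ≤ n - 1 → b * g n i = 0) (x : TLB n) :
    b * x = signChar n hε x • b := by
  induction x using tlb_induction with
  | halg a =>
    rw [AlgHom.commutes, Algebra.smul_def, Algebra.algebraMap_self_apply, Algebra.commutes]
  | hg i hin =>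
    rcases Nat.eq_zero_or_pos i with rfl | h
    · rw [h0, signChar_g_zero hε hn]
    · rw [hi i h (by omega), signChar_g hε h, zero_smul]
  | hmul x y hx hy => rw [← mul_assoc, hx, smul_mul_assoc, hy, smul_smul, map_mul]
  | hadd x y hx hy => rw [mul_add, hx, hy, map_add, add_smul]

theorem IsJW.signChar_eq_one (hε : ε * ε = 1) (hn : 1 ≤ n) {b : TLB n} (hb : IsJW n ε b) :
    signChar n hε b = 1 := by
  obtain ⟨hne, hsq, h0, -, hi⟩ := hb
  have h := mul_eq_signChar_smul hε hn h0 (fun i h h' ↦ (hi i h h').1) b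
  rw [hsq] at h
  by_contra hχ
  refine hne ((smul_eq_zero.1 ?_).resolve_left (sub_ne_zero.2 hχ))
  rw [sub_smul, one_smul, ← h, sub_self]

theorem IsJW.eq (hε : ε * ε = 1) (hn : 1 ≤ n) {b b' : TLB n} (hb : IsJW n ε b)
    (hb' : IsJW n ε b') : b = b' := by
  have h₁ := mul_eq_signChar_smul' hε hn hb.2.2.2.1 (fun i h h' ↦ (hb.2.2.2.2 i h h').2) b'
  have h₂ := mul_eq_signChar_smul hε hn hb'.2.2.1 (fun i h h' ↦ (hb'.2.2.2.2 i h h').1) b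
  rw [hb'.signChar_eq_one hε hn, one_smul] at h₁
  rw [hb.signChar_eq_one hε hn, one_smul] at h₂
  exact h₁.symm.trans h₂

end Character

/-! ### Construction of the projector -/

section Construction

variable {n : ℕ} {ε : K}

/-- The projector on the first `k` strands; for `k = 0` it is `1`, for `k = 1` it is the
projector onto the `ε`-eigenspace of `s₀`. -/
def jwProj (n : ℕ) (ε : K) : ℕ → TLB n
  | 0 => 1
  | 1 => (2⁻¹ : K) • (1 + ε • g n 0)
  | k + 2 => wenzlStep (qSum k / qSum (k + 1)) (jwProj n ε (k + 1)) (g n (k + 1))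

theorem jwProj_one : jwProj n ε 1 = (2⁻¹ : K) • (1 + ε • g n 0) := by
  rw [jwProj]

theorem jwProj_add_two (k : ℕ) : jwProj n ε (k + 2) =
    wenzlStep (qSum k / qSum (k + 1)) (jwProj n ε (k + 1)) (g n (k + 1)) := by
  rw [jwProj]

theorem jwProj_commute (k : ℕ) {j : ℕ} (hj : k + 1 ≤ j) : Commute (jwProj n ε k) (g n j) := by
  induction k using Nat.twoStepInduction generalizing j with
  | zero => exact Commute.one_left _
  | one =>
    rw [jwProj_one]
    exact ((Commute.one_left _).add_left ((g_commute (by omega)).smul_left _)).smul_left _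
  | more k _ ih =>
    have h := ih (j := j) (by omega)
    rw [jwProj_add_two, wenzlStep]
    exact h.sub_left (((h.mul_left (g_commute (by omega))).mul_left h).smul_left _)

theorem g_zero_mul_jwProj (hε : ε * ε = 1) (hn : 1 ≤ n) (k : ℕ) :
    g n 0 * jwProj n ε (k + 1) = ε • jwProj n ε (k + 1) := by
  induction k with
  | zero =>
    rw [zero_add, jwProj_one, mul_smul_comm, mul_add, mul_smul_comm, g_zero_mul_self hn, mul_one,
      smul_comm, smul_add ε, smul_smul ε ε, hε, one_smul, add_comm]
  | succ k ih => rw [jwProj_add_two]; exact mul_wenzlStep_of_mul_eq ih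

theorem jwProj_mul_g_zero (hε : ε * ε = 1) (hn : 1 ≤ n) (k : ℕ) :
    jwProj n ε (k + 1) * g n 0 = ε • jwProj n ε (k + 1) := by
  induction k with
  | zero =>
    rw [zero_add, jwProj_one, smul_mul_assoc, add_mul, smul_mul_assoc, g_zero_mul_self hn, one_mul,
      smul_comm, smul_add ε, smul_smul ε ε, hε, one_smul, add_comm]
  | succ k ih => rw [jwProj_add_two]; exact wenzlStep_mul_of_mul_eq ih

theorem jwProj_one_isIdempotentElem (hε : ε * ε = 1) (hn : 1 ≤ n) :
    IsIdempotentElem (jwProj n ε 1) := by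
  have h := g_zero_mul_jwProj hε hn 0
  rw [zero_add] at h
  rw [IsIdempotentElem]
  nth_rewrite 1 [jwProj_one]
  rw [smul_mul_assoc, add_mul, one_mul, smul_mul_assoc, h, smul_smul, hε, one_smul, ← two_smul K,
    smul_smul, inv_mul_cancel₀ two_ne_zero, one_smul]

/-- Idempotency, absorption and the partial trace identity, proved simultaneously. -/
theorem jwProj_recursion (hε : ε * ε = 1) (hn : 1 ≤ n) (k : ℕ) :
    IsIdempotentElem (jwProj n ε (k + 1)) ∧
      jwProj n ε k * jwProj n ε (k + 1) = jwProj n ε (k + 1) ∧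
      jwProj n ε (k + 1) * jwProj n ε k = jwProj n ε (k + 1) ∧
      (qSum k / qSum (k + 1)) • (g n (k + 1) * jwProj n ε (k + 1) * g n (k + 1)) =
        jwProj n ε k * g n (k + 1) := by
  induction k with
  | zero =>
    refine ⟨jwProj_one_isIdempotentElem hε hn, by simp [jwProj], by simp [jwProj], ?_⟩
    have h : g n 1 * jwProj n ε 1 * g n 1 = (2⁻¹ * δ) • g n 1 := by
      rw [jwProj_one, mul_smul_comm, smul_mul_assoc, mul_add, add_mul, mul_one, mul_smul_comm,
        smul_mul_assoc, g_one_mul_g_zero_mul_g_one, smul_zero, add_zero, g_mul_self le_rfl,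
        smul_smul]
    have hδ : qSum 0 / qSum 1 * (2⁻¹ * δ) = 1 := by
      have h0 : qSum 0 = 2 := by norm_num [qSum]
      have h1 : qSum 1 = δ := by simp [qSum, δ]
      have hne : δ ≠ 0 := h1 ▸ qSum_ne_zero 1
      rw [h0, h1]
      field_simp
    rw [zero_add, h, smul_smul, hδ, one_smul, jwProj, one_mul]
  | succ k ih =>
    obtain ⟨he, hde, hed, hc⟩ := ih
    have hu : jwProj n ε (k + 2) * g n (k + 1) = 0 := by
      rw [jwProj_add_two]; exact wenzlStep_mul hed hc
    refine ⟨?_, ?_, ?_, ?_⟩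
    · rw [jwProj_add_two] at hu ⊢
      exact wenzlStep_isIdempotentElem he hu
    · rw [jwProj_add_two]
      simpa using mul_wenzlStep_of_mul_eq (c := qSum k / qSum (k + 1)) (u := g n (k + 1))
        (a := (1 : K)) (by simpa using he.eq)
    · rw [jwProj_add_two]
      simpa using wenzlStep_mul_of_mul_eq (c := qSum k / qSum (k + 1)) (u := g n (k + 1))
        (a := (1 : K)) (by simpa using he.eq)
    · have h₁ := qSum_ne_zero (k + 1)
      have h₂ := qSum_ne_zero (k + 2)
      rw [jwProj_add_two, mul_wenzlStep_mul he (jwProj_commute (k + 1) le_rfl)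
        (g_mul_self (by omega)) (g_succ_mul_g_mul_g_succ (by omega)), delta_sub_div, smul_smul,
        div_mul_div_cancel₀ h₂, div_self h₁, one_smul]

theorem g_mul_jwProj (hε : ε * ε = 1) (hn : 1 ≤ n) (k : ℕ) {i : ℕ} (hi : 1 ≤ i) (hik : i ≤ k) :
    g n i * jwProj n ε (k + 1) = 0 := by
  induction k with
  | zero => omega
  | succ k ih =>
    rw [jwProj_add_two]
    rcases Nat.le_succ_iff.1 hik with h | rfl
    · rw [mul_wenzlStep_of_mul_eq (a := (0 : K)) (by rw [ih h, zero_smul]), zero_smul]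
    · obtain ⟨-, hde, -, hc⟩ := jwProj_recursion hε hn k
      exact mul_wenzlStep hde (jwProj_commute k le_rfl) hc

theorem jwProj_mul_g (hε : ε * ε = 1) (hn : 1 ≤ n) (k : ℕ) {i : ℕ} (hi : 1 ≤ i) (hik : i ≤ k) :
    jwProj n ε (k + 1) * g n i = 0 := by
  induction k with
  | zero => omega
  | succ k ih =>
    rw [jwProj_add_two]
    rcases Nat.le_succ_iff.1 hik with h | rfl
    · rw [wenzlStep_mul_of_mul_eq (a := (0 : K)) (by rw [ih h, zero_smul]), zero_smul]
    · obtain ⟨-, -, hed, hc⟩ := jwProj_recursion hε hn k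
      exact wenzlStep_mul hed hc

theorem signChar_jwProj (hε : ε * ε = 1) (hn : 1 ≤ n) (k : ℕ) :
    signChar n hε (jwProj n ε (k + 1)) = 1 := by
  induction k with
  | zero =>
    rw [zero_add, jwProj_one, map_smul, map_add, map_one, map_smul, signChar_g_zero hε hn,
      smul_eq_mul, smul_eq_mul, hε, one_add_one_eq_two, inv_mul_cancel₀ two_ne_zero]
  | succ k ih =>
    rw [jwProj_add_two, wenzlStep, map_sub, map_smul, map_mul, map_mul,
      signChar_g hε (by omega), ih, mul_zero, zero_mul, smul_zero, sub_zero]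

theorem isJW_jwProj (hε : ε * ε = 1) (hn : 1 ≤ n) : IsJW n ε (jwProj n ε n) := by
  obtain ⟨k, rfl⟩ : ∃ k, n = k + 1 := ⟨n - 1, by omega⟩
  refine ⟨fun h ↦ ?_, (jwProj_recursion hε hn k).1, g_zero_mul_jwProj hε hn k,
    jwProj_mul_g_zero hε hn k,
    fun i hi hik ↦ ⟨g_mul_jwProj hε hn k hi hik, jwProj_mul_g hε hn k hi hik⟩⟩
  have h1 := signChar_jwProj hε hn k
  rw [h, map_zero] at h1
  exact zero_ne_one h1

end Construction

/-- For `n ≥ 1` and each sign `ε ∈ {1, -1}` there is a unique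
`b ∈ TL(Bₙ)` with `b ≠ 0`, `b² = b`, `s₀·b = ε·b = b·s₀`, and `Uᵢ·b = 0 = b·Uᵢ` for all
`1 ≤ i ≤ n-1`. -/
theorem stmt_11 (n : ℕ) (hn : 1 ≤ n) (ε : K) (hε : ε = 1 ∨ ε = -1) :
    ∃! b : TLB n, b ≠ 0 ∧ b * b = b ∧ g n 0 * b = ε • b ∧ b * g n 0 = ε • b ∧
      ∀ i : ℕ, 1 ≤ i → i ≤ n - 1 → g n i * b = 0 ∧ b * g n i = 0 := by
  have hε' : ε * ε = 1 := by rcases hε with rfl | rfl <;> norm_num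
  exact ⟨jwProj n ε n, isJW_jwProj hε' hn, fun b hb ↦ IsJW.eq hε' hn hb (isJW_jwProj hε' hn)⟩
end
end
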